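/- arXiv:0802.0890 — 2 statements merged into one kernel-verified Lean document; each statement's English description precedes it below -/
import Mathlib

section
/- Let 0 < α ≤ 1/2, let f ∈ 𝒜_α be outer with ‖f‖_{𝒜_α} ≤ 1, let 1 < ρ ≤ 2, let Γ be a union of component arcs of 𝕋\E_f, and let γ = (a,b) be a component arc of 𝕋\E_f of arclength < 1/2. Then ∫_{Δ_γ²¹} |f(z)|^{2ρ} a_γ(z)² dA(z) ≤ C_ρ · ∫_{Δ_γ} |f'(z)|² dA(z), where C_ρ > 0 depends only on ρ and α. -/
open Complex MeasureTheory Set Metric Filter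
open scoped ENNReal Classical

noncomputable section

/-- The open unit disc in `ℂ`. -/
def uDisc : Set ℂ := Metric.ball 0 1

/-- The unit circle in `ℂ`. -/
def uCircle : Set ℂ := Metric.sphere (0 : ℂ) 1

/-- `f` is analytic on the open unit disc and continuous on the closed unit disc. -/
def IsDiscReg (f : ℂ → ℂ) : Prop :=
  DifferentiableOn ℂ f uDisc ∧ ContinuousOn f (Metric.closedBall 0 1)

/-- The little-o Lipschitz condition of order `α` on the closed unit disc:
`|f z - f w| = o(|z-w|^α)` as `|z - w| → 0`. -/
def LittleLip (α : ℝ) (f : ℂ → ℂ) : Prop :=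
  ∀ ε > 0, ∃ δ > 0, ∀ z ∈ Metric.closedBall (0 : ℂ) 1, ∀ w ∈ Metric.closedBall (0 : ℂ) 1,
    ‖z - w‖ < δ → ‖f z - f w‖ ≤ ε * ‖z - w‖ ^ α

/-- Membership in `lip_α`. -/
def MemLip (α : ℝ) (f : ℂ → ℂ) : Prop := IsDiscReg f ∧ LittleLip α f

/-- The Dirichlet integral `D(f) = ∫_𝔻 |f'|² dA` with respect to the normalized
area measure `dA = (1/π)·(Lebesgue)`. -/
def dirInt (f : ℂ → ℂ) : ℝ := (1 / Real.pi) * ∫ z in uDisc, ‖deriv f z‖ ^ 2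

/-- Membership in the Dirichlet space `𝒟`. -/
def MemDir (f : ℂ → ℂ) : Prop :=
  DifferentiableOn ℂ f uDisc ∧ IntegrableOn (fun z => ‖deriv f z‖ ^ 2) uDisc

/-- Sup norm over the unit disc. -/
def supNorm (f : ℂ → ℂ) : ℝ := sSup ((fun z => ‖f z‖) '' uDisc)

/-- The `lip_α` norm `‖f‖_α = ‖f‖_∞ + sup_{z∈𝔻} (1-|z|)^{1-α}|f'(z)|`. -/
def lipNorm (α : ℝ) (f : ℂ → ℂ) : ℝ :=
  supNorm f + sSup ((fun z => (1 - ‖z‖) ^ (1 - α) * ‖deriv f z‖) '' uDisc)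

/-- The `𝒜_α` norm `‖f‖_{𝒜_α} = ‖f‖_α + D(f)^{1/2}`. -/
def ANorm (α : ℝ) (f : ℂ → ℂ) : ℝ := lipNorm α f + Real.sqrt (dirInt f)

/-- Membership in `𝒜_α = 𝒟 ∩ lip_α`. -/
def MemA (α : ℝ) (f : ℂ → ℂ) : Prop := MemDir f ∧ MemLip α f

/-- A closed ideal of the Banach algebra `𝒜_α`, encoded as a set of functions `ℂ → ℂ`
(two functions agreeing on the closed disc represent the same element of `𝒜_α`). -/
structure IsClosedIdeal (α : ℝ) (J : Set (ℂ → ℂ)) : Prop where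
  mem_A : ∀ f ∈ J, MemA α f
  zero_mem : (0 : ℂ → ℂ) ∈ J
  add_mem : ∀ f ∈ J, ∀ g ∈ J, f + g ∈ J
  smul_mem : ∀ (c : ℂ), ∀ f ∈ J, c • f ∈ J
  mul_mem : ∀ f ∈ J, ∀ g : ℂ → ℂ, MemA α g → f * g ∈ J
  ext_mem : ∀ f ∈ J, ∀ g : ℂ → ℂ, MemA α g →
    (∀ z ∈ Metric.closedBall (0 : ℂ) 1, g z = f z) → g ∈ J
  closed : ∀ (F : ℕ → ℂ → ℂ) (f : ℂ → ℂ), (∀ n, F n ∈ J) → MemA α f →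
    Tendsto (fun n => ANorm α (F n - f)) atTop (nhds 0) → f ∈ J

/-- The boundary zero set `E_f = {ξ ∈ 𝕋 : f ξ = 0}`. -/
def bZeros (f : ℂ → ℂ) : Set ℂ := {ξ | ξ ∈ uCircle ∧ f ξ = 0}

/-- An inner function: bounded analytic on `𝔻` with radial limits of modulus `1`
at almost every point of `𝕋`. -/
def IsInner (U : ℂ → ℂ) : Prop :=
  DifferentiableOn ℂ U uDisc ∧ (∀ z ∈ uDisc, ‖U z‖ ≤ 1) ∧
    ∀ᵐ θ : ℝ, Tendsto (fun r : ℝ => ‖U ((r : ℂ) * Complex.exp ((θ : ℂ) * Complex.I))‖)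
      (nhdsWithin 1 (Set.Iio 1)) (nhds 1)

/-- The Schwarz/Herglotz kernel `(e^{iθ}+z)/(e^{iθ}-z)`. -/
def circleKernel (z : ℂ) (θ : ℝ) : ℂ :=
  (Complex.exp ((θ : ℂ) * Complex.I) + z) / (Complex.exp ((θ : ℂ) * Complex.I) - z)

/-- `f` is an outer function. -/
def IsOuter (f : ℂ → ℂ) : Prop :=
  IsDiscReg f ∧ (∃ z ∈ uDisc, f z ≠ 0) ∧
    ∀ z ∈ uDisc, f z = Complex.exp ((1 / (2 * (Real.pi : ℂ))) *
      ∫ θ in (0:ℝ)..(2 * Real.pi),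
        circleKernel z θ * (Real.log ‖f (Complex.exp ((θ : ℂ) * Complex.I))‖ : ℂ))

/-- The outer power `f^ρ`, the outer function with boundary modulus `|f|^ρ`. -/
def outerPow (f : ℂ → ℂ) (ρ : ℝ) (z : ℂ) : ℂ :=
  Complex.exp (((ρ : ℂ) / (2 * (Real.pi : ℂ))) *
    ∫ θ in (0:ℝ)..(2 * Real.pi),
      circleKernel z θ * (Real.log ‖f (Complex.exp ((θ : ℂ) * Complex.I))‖ : ℂ))

/-- The set of angles in `[0, 2π)` whose corresponding point of the circle lies in `A`. -/
def angSet (A : Set ℂ) : Set ℝ :=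
  {θ | θ ∈ Set.Ico (0 : ℝ) (2 * Real.pi) ∧ Complex.exp ((θ : ℂ) * Complex.I) ∈ A}

/-- The outer factor `f_Γ` associated with a boundary set `Γ ⊆ 𝕋`. -/
def outerPart (f : ℂ → ℂ) (Γ : Set ℂ) (z : ℂ) : ℂ :=
  Complex.exp ((1 / (2 * (Real.pi : ℂ))) *
    ∫ θ in angSet Γ, circleKernel z θ * (Real.log ‖f (Complex.exp ((θ : ℂ) * Complex.I))‖ : ℂ))

/-- `𝕋 \ E_f`, the set of boundary points where `f` does not vanish. -/
def offZeros (f : ℂ → ℂ) : Set ℂ := {ξ | ξ ∈ uCircle ∧ f ξ ≠ 0}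

/-- `γ` is a component arc (connected component) of `𝕋 \ E_f`. -/
def IsCompArc (f : ℂ → ℂ) (γ : Set ℂ) : Prop :=
  ∃ x ∈ offZeros f, γ = connectedComponentIn (offZeros f) x

/-- `Γ` is a union of component arcs of `𝕋 \ E_f`. -/
def IsArcUnion (f : ℂ → ℂ) (Γ : Set ℂ) : Prop :=
  Γ ⊆ offZeros f ∧ ∀ x ∈ Γ, connectedComponentIn (offZeros f) x ⊆ Γ

/-- The sector `Δ_γ = {z ∈ 𝔻 : z/|z| ∈ γ}`. -/
def discSector (γ : Set ℂ) : Set ℂ := {z | z ∈ uDisc ∧ ((‖z‖ : ℂ))⁻¹ * z ∈ γ}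

/-- Lower integral of `g` over `S` with respect to the normalized area measure
`dA = (1/π)·(Lebesgue)`. -/
def nlint (S : Set ℂ) (g : ℂ → ℝ) : ℝ≥0∞ :=
  ENNReal.ofReal (1 / Real.pi) * ∫⁻ z in S, ENNReal.ofReal (g z)

/-- `d(z) = min(|z-a|, |z-b|)`, distance to the endpoints of the arc `γ = (a,b)`. -/
def dd (a b z : ℂ) : ℝ := min ‖z - a‖ ‖z - b‖

/-- `Λ_γ`: equals `Γ` if `γ ⊄ Γ`, and `𝕋 \ Γ` if `γ ⊆ Γ`. -/
def lamSet (Γ γ : Set ℂ) : Set ℂ := if γ ⊆ Γ then uCircle \ Γ else Γ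

/-- The function `a_γ(z) = (1/2π)∫_{Λ_γ} (−log|f(e^{iθ})|)/|e^{iθ}−z|² dθ`. -/
def aFun (f : ℂ → ℂ) (Γ γ : Set ℂ) (z : ℂ) : ℝ :=
  (1 / (2 * Real.pi)) * ∫ θ in angSet (lamSet Γ γ),
    (-(Real.log ‖f (Complex.exp ((θ : ℂ) * Complex.I))‖)) /
      ‖Complex.exp ((θ : ℂ) * Complex.I) - z‖ ^ 2

/-- `Δ_γ¹ = {z ∈ Δ_γ : d(z) < 2(1−|z|)}`. -/
def sector1 (a b : ℂ) (γ : Set ℂ) : Set ℂ :=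
  {z | z ∈ discSector γ ∧ dd a b z < 2 * (1 - ‖z‖)}

/-- `Δ_γ² = {z ∈ Δ_γ : d(z) ≥ 2(1−|z|)}`. -/
def sector2 (a b : ℂ) (γ : Set ℂ) : Set ℂ :=
  {z | z ∈ discSector γ ∧ 2 * (1 - ‖z‖) ≤ dd a b z}

/-- `Δ_γ²¹ = {z ∈ Δ_γ² : a_γ(z) ≤ 8|log d(z)|/d(z)}`. -/
def sector21 (f : ℂ → ℂ) (Γ γ : Set ℂ) (a b : ℂ) : Set ℂ :=
  {z | z ∈ sector2 a b γ ∧ aFun f Γ γ z ≤ 8 * |Real.log (dd a b z)| / dd a b z}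

/-- `Δ_γ²² = {z ∈ Δ_γ² : 8|log d(z)|/d(z) < a_γ(z) < 8|log d(z)|/(1−|z|)}`. -/
def sector22 (f : ℂ → ℂ) (Γ γ : Set ℂ) (a b : ℂ) : Set ℂ :=
  {z | z ∈ sector2 a b γ ∧ 8 * |Real.log (dd a b z)| / dd a b z < aFun f Γ γ z ∧
    aFun f Γ γ z < 8 * |Real.log (dd a b z)| / (1 - ‖z‖)}

/-- `Δ_γ²³ = {z ∈ Δ_γ² : a_γ(z) ≥ 8|log d(z)|/(1−|z|)}`. -/
def sector23 (f : ℂ → ℂ) (Γ γ : Set ℂ) (a b : ℂ) : Set ℂ :=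
  {z | z ∈ sector2 a b γ ∧ 8 * |Real.log (dd a b z)| / (1 - ‖z‖) ≤ aFun f Γ γ z}

/-- `μ_z = 1 − 8|log d(z)|/a_γ(z)`. -/
def muOf (f : ℂ → ℂ) (Γ γ : Set ℂ) (a b : ℂ) (z : ℂ) : ℝ :=
  1 - 8 * |Real.log (dd a b z)| / aFun f Γ γ z

/-- The tail union `Γ_m = ⋃_{p ≥ m} γ_p`. -/
def tailUnion (γ : ℕ → Set ℂ) (m : ℕ) : Set ℂ := ⋃ p ∈ Set.Ici m, γ p

end

theorem bddAbove_weighted_deriv {α : ℝ} {f : ℂ → ℂ} (hα : α ≤ 1) (hf : MemLip α f) :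
    BddAbove ((fun z => (1 - ‖z‖) ^ (1 - α) * ‖deriv f z‖) '' uDisc) := by
  obtain ⟨⟨hd, hc⟩, hl⟩ := hf
  obtain ⟨δ, hδ, hl⟩ := hl 1 one_pos
  obtain ⟨M, hM⟩ := (isCompact_closedBall (0 : ℂ) 1).exists_bound_of_continuousOn hc
  have hM0 : 0 ≤ M := (norm_nonneg _).trans (hM 0 (by simp))
  refine ⟨2 ^ (1 - α) + M / δ, ?_⟩
  rintro _ ⟨z, hz, rfl⟩
  have hz1 : ‖z‖ < 1 := by simpa [uDisc] using hz
  set R := (1 - ‖z‖) / 2 with hR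
  have hR0 : 0 < R := by linarith
  have hsub : closedBall z R ⊆ uDisc := by
    intro w hw
    have h1 : ‖w - z‖ ≤ R := by simpa [dist_eq_norm] using hw
    have h2 : ‖w‖ ≤ ‖w - z‖ + ‖z‖ := by simpa using norm_add_le (w - z) z
    simp only [uDisc, mem_ball_zero_iff]
    linarith
  have hcl : ∀ w ∈ uDisc, w ∈ closedBall (0 : ℂ) 1 := fun w hw => ball_subset_closedBall hw
  have hreg : DiffContOnCl ℂ f (ball z R) := by
    refine ⟨hd.mono (ball_subset_closedBall.trans hsub), ?_⟩
    rw [closure_ball _ hR0.ne']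
    exact hd.continuousOn.mono hsub
  have hMδ : 0 ≤ M / δ := by positivity
  dsimp only
  rcases lt_or_ge R δ with h | h
  · have hb : ‖deriv f z‖ ≤ R ^ α / R := by
      rw [← deriv_sub_const (f z)]
      refine norm_deriv_le_of_forall_mem_sphere_norm_le hR0 (hreg.sub_const _) fun w hw => ?_
      have hw' : ‖w - z‖ = R := by simpa [dist_eq_norm] using hw
      have := hl w (hcl _ (hsub (sphere_subset_closedBall hw))) z (hcl _ hz) (by rw [hw']; exact h)
      simpa [hw'] using this
    have h2 : (1 - ‖z‖) ^ (1 - α) = 2 ^ (1 - α) * R ^ (1 - α) := by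
      rw [← Real.mul_rpow (by norm_num) hR0.le]
      congr 1
      rw [hR]; ring
    have h3 : (2 : ℝ) ^ (1 - α) * R ^ (1 - α) * (R ^ α / R) = 2 ^ (1 - α) := by
      have : R ^ (1 - α) * R ^ α = R := by rw [← Real.rpow_add hR0]; simp
      rw [mul_assoc, ← mul_div_assoc, this, div_self hR0.ne', mul_one]
    have h4 : (2 : ℝ) ^ (1 - α) * R ^ (1 - α) * ‖deriv f z‖ ≤ 2 ^ (1 - α) :=
      (mul_le_mul_of_nonneg_left hb (by positivity)).trans_eq h3
    rw [h2]
    linarith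
  · have hb : ‖deriv f z‖ ≤ M / R :=
      norm_deriv_le_of_forall_mem_sphere_norm_le hR0 hreg
        fun w hw => hM w (hcl _ (hsub (sphere_subset_closedBall hw)))
    have h1 : (1 - ‖z‖) ^ (1 - α) ≤ 1 :=
      Real.rpow_le_one (by linarith) (by linarith [norm_nonneg z]) (by linarith)
    calc _ ≤ 1 * (M / δ) := by
          gcongr
          exact hb.trans (by gcongr)
      _ ≤ _ := by linarith [Real.rpow_nonneg (zero_le_two (α := ℝ)) (1 - α)]

theorem supNorm_nonneg (f : ℂ → ℂ) : 0 ≤ supNorm f :=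
  Real.sSup_nonneg (by rintro _ ⟨z, -, rfl⟩; exact norm_nonneg _)

theorem sSup_weighted_deriv_nonneg (α : ℝ) (f : ℂ → ℂ) :
    0 ≤ sSup ((fun z => (1 - ‖z‖) ^ (1 - α) * ‖deriv f z‖) '' uDisc) := by
  refine Real.sSup_nonneg ?_
  rintro _ ⟨z, hz, rfl⟩
  have hz1 : ‖z‖ < 1 := by simpa [uDisc] using hz
  exact mul_nonneg (Real.rpow_nonneg (by linarith) _) (norm_nonneg _)

theorem norm_deriv_le_of_ANorm_le_one {α : ℝ} {f : ℂ → ℂ} (hα : α ≤ 1) (hf : MemA α f)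
    (hn : ANorm α f ≤ 1) {z : ℂ} (hz : ‖z‖ < 1) : ‖deriv f z‖ ≤ (1 - ‖z‖) ^ (α - 1) := by
  have h1 : (1 - ‖z‖) ^ (1 - α) * ‖deriv f z‖ ≤ 1 := by
    refine (le_csSup (bddAbove_weighted_deriv hα hf.2)
      (mem_image_of_mem _ (show z ∈ uDisc by simpa [uDisc] using hz))).trans ?_
    unfold ANorm lipNorm at hn
    linarith [supNorm_nonneg f, Real.sqrt_nonneg (dirInt f)]
  have h0 : 0 < 1 - ‖z‖ := by linarith
  have h2 : (1 - ‖z‖) ^ (α - 1) = ((1 - ‖z‖) ^ (1 - α))⁻¹ := by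
    rw [← Real.rpow_neg h0.le]; ring_nf
  rw [h2, ← one_div, le_div_iff₀ (by positivity)]
  linarith

theorem norm_le_one_of_ANorm_le_one {α : ℝ} {f : ℂ → ℂ} (hf : MemA α f)
    (hn : ANorm α f ≤ 1) {z : ℂ} (hz : z ∈ closedBall (0 : ℂ) 1) : ‖f z‖ ≤ 1 := by
  have hc : ContinuousOn f (closedBall 0 1) := hf.2.1.2
  obtain ⟨M, hM⟩ := (isCompact_closedBall (0 : ℂ) 1).exists_bound_of_continuousOn hc
  have hdisc : ∀ w ∈ ball (0 : ℂ) 1, ‖f w‖ ≤ 1 := by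
    intro w hw
    refine (le_csSup (s := (fun z => ‖f z‖) '' uDisc) ⟨M, ?_⟩ (mem_image_of_mem _ hw)).trans ?_
    · rintro _ ⟨v, hv, rfl⟩
      exact hM v (ball_subset_closedBall hv)
    · change supNorm f ≤ 1
      unfold ANorm lipNorm at hn
      linarith [sSup_weighted_deriv_nonneg α f, Real.sqrt_nonneg (dirInt f)]
  rw [← closure_ball (0 : ℂ) one_ne_zero] at hz hc
  exact le_on_closure hdisc hc.norm continuousOn_const hz

/-- Moving from `z` towards the origin by the factor `1 - t`. -/
theorem norm_sub_radial_le {α : ℝ} {f : ℂ → ℂ} (hα0 : 0 < α) (hα : α ≤ 1) (hf : MemA α f)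
    (hn : ANorm α f ≤ 1) {z : ℂ} (hz : ‖z‖ ≤ 1) {t : ℝ} (ht0 : 0 < t) (ht : t ≤ 1) :
    ‖f z - f ((1 - t : ℝ) * z)‖ ≤ t ^ α / α := by
  have hlt : ∀ x ∈ Ico 0 t, ‖((1 - t + x : ℝ) : ℂ) * z‖ ≤ 1 - (t - x) := by
    intro x hx
    rw [norm_mul, norm_real, Real.norm_of_nonneg (by linarith [hx.1])]
    nlinarith [hx.1, hx.2, norm_nonneg z]
  have key := image_norm_le_of_norm_deriv_right_le_deriv_boundary' (a := 0) (b := t)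
    (f := fun x : ℝ => f ((1 - t + x : ℝ) * z) - f ((1 - t : ℝ) * z))
    (f' := fun x : ℝ => deriv f ((1 - t + x : ℝ) * z) * z)
    (B := fun x => t ^ α / α - (t - x) ^ α / α) (B' := fun x => (t - x) ^ (α - 1))
    ?_ ?_ ?_ ?_ ?_ ?_ (right_mem_Icc.2 ht0.le)
  · simpa [Real.zero_rpow hα0.ne'] using key
  · refine ContinuousOn.sub (hf.2.1.2.comp (by fun_prop) ?_) continuousOn_const
    intro x hx
    rw [mem_closedBall_zero_iff, norm_mul, norm_real, Real.norm_of_nonneg (by linarith [hx.1])]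
    nlinarith [hx.1, hx.2, norm_nonneg z]
  · intro x hx
    have hin : ((1 - t + x : ℝ) : ℂ) * z ∈ uDisc := by
      simp only [uDisc, mem_ball_zero_iff]
      linarith [hlt x hx, hx.2]
    have h1 : HasDerivAt f (deriv f ((1 - t + x : ℝ) * z)) ((1 - t + x : ℝ) * z) :=
      (hf.1.1.differentiableAt (isOpen_ball.mem_nhds hin)).hasDerivAt
    have h2 : HasDerivAt (fun x : ℝ => ((1 - t + x : ℝ) : ℂ) * z) z x := by
      have := (((hasDerivAt_id x).const_add (1 - t)).ofReal_comp).mul_const z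
      simpa using this
    exact ((h1.comp x h2).sub_const _).hasDerivWithinAt
  · simp
  · refine ContinuousOn.sub continuousOn_const (ContinuousOn.div_const ?_ _)
    exact ContinuousOn.rpow_const (by fun_prop) fun _ _ => Or.inr hα0.le
  · intro x hx
    have h := (((hasDerivAt_id x).const_sub t).rpow_const (p := α)
      (Or.inl (by simp only [id]; linarith [hx.2]))).div_const α
    have h' := (h.const_sub (t ^ α / α)).hasDerivWithinAt (s := Ici x)
    refine h'.congr_deriv ?_
    simp only [id]
    field_simp
  · intro x hx
    have h := hlt x hx
    have hx2 := hx.2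
    rw [norm_mul]
    calc _ ≤ (1 - ‖((1 - t + x : ℝ) : ℂ) * z‖) ^ (α - 1) * 1 :=
          mul_le_mul (norm_deriv_le_of_ANorm_le_one hα hf hn (by linarith)) hz (norm_nonneg _)
            (Real.rpow_nonneg (by linarith) _)
      _ ≤ (t - x) ^ (α - 1) := by
          rw [mul_one]
          exact Real.rpow_le_rpow_of_nonpos (by linarith) (by linarith) (by linarith)

theorem norm_le_mul_dist_rpow {α : ℝ} {f : ℂ → ℂ} (hα0 : 0 < α) (hα : α ≤ 1) (hf : MemA α f)
    (hn : ANorm α f ≤ 1) {p z : ℂ} (hp : ‖p‖ ≤ 1) (hz : ‖z‖ ≤ 1) (hfp : f p = 0) :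
    ‖f z‖ ≤ (2 / α + 1) * ‖z - p‖ ^ α := by
  have hα2 : 0 < 2 / α := by positivity
  rcases eq_or_ne z p with rfl | hne
  · rw [hfp, norm_zero]; positivity
  have ht0 : 0 < ‖z - p‖ := norm_pos_iff.2 (sub_ne_zero.2 hne)
  rcases lt_or_ge 1 ‖z - p‖ with h | ht
  · have h1 : 1 ≤ ‖z - p‖ ^ α := Real.one_le_rpow h.le hα0.le
    have h2 := norm_le_one_of_ANorm_le_one hf hn (z := z) (by simpa using hz)
    nlinarith
  set t := ‖z - p‖ with ht'
  have e1 := norm_sub_radial_le hα0 hα hf hn hz ht0 ht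
  have e2 := norm_sub_radial_le hα0 hα hf hn hp ht0 ht
  have hsub : ∀ w ∈ closedBall (0 : ℂ) (1 - t), ‖w‖ ≤ 1 - t := by simp
  have hmem : ∀ w : ℂ, ‖w‖ ≤ 1 → ((1 - t : ℝ) : ℂ) * w ∈ closedBall (0 : ℂ) (1 - t) := by
    intro w hw
    rw [mem_closedBall_zero_iff, norm_mul, norm_real, Real.norm_of_nonneg (by linarith)]
    nlinarith [norm_nonneg w]
  have e3 : ‖f ((1 - t : ℝ) * z) - f ((1 - t : ℝ) * p)‖ ≤
      t ^ (α - 1) * ‖((1 - t : ℝ) : ℂ) * z - (1 - t : ℝ) * p‖ := by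
    refine Convex.norm_image_sub_le_of_norm_deriv_le (s := closedBall (0 : ℂ) (1 - t))
      (fun w hw => ?_) (fun w hw => ?_) (convex_closedBall _ _) (hmem p hp) (hmem z hz)
    · have := hsub w hw
      exact hf.1.1.differentiableAt (isOpen_ball.mem_nhds (by rw [mem_ball_zero_iff]; linarith))
    · have := hsub w hw
      exact (norm_deriv_le_of_ANorm_le_one hα hf hn (by linarith)).trans
        (Real.rpow_le_rpow_of_nonpos ht0 (by linarith) (by linarith))
  have e4 : t ^ (α - 1) * ‖((1 - t : ℝ) : ℂ) * z - (1 - t : ℝ) * p‖ ≤ t ^ α := by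
    rw [← mul_sub, norm_mul, norm_real, Real.norm_of_nonneg (by linarith), ← ht']
    have : t ^ α = t ^ (α - 1) * t := by
      rw [← Real.rpow_add_one ht0.ne']; simp
    rw [this]
    gcongr
    nlinarith
  have e5 : f z = (f z - f ((1 - t : ℝ) * z)) + (f ((1 - t : ℝ) * z) - f ((1 - t : ℝ) * p))
      - (f p - f ((1 - t : ℝ) * p)) := by rw [hfp]; ring
  calc ‖f z‖ ≤ ‖f z - f ((1 - t : ℝ) * z)‖ + ‖f ((1 - t : ℝ) * z) - f ((1 - t : ℝ) * p)‖
        + ‖f p - f ((1 - t : ℝ) * p)‖ := by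
        conv_lhs => rw [e5]
        exact (norm_sub_le _ _).trans (by gcongr; exact norm_add_le _ _)
    _ ≤ t ^ α / α + t ^ α + t ^ α / α := by linarith
    _ = _ := by ring

theorem lipschitzWith_exp_ofReal_mul_I :
    LipschitzWith 1 fun θ : ℝ => Complex.exp (θ * Complex.I) := by
  have hd : ∀ θ : ℝ, HasDerivAt (fun θ : ℝ => Complex.exp (θ * Complex.I))
      (Complex.exp (θ * Complex.I) * Complex.I) θ := by
    intro θ
    simpa using ((hasDerivAt_id θ).ofReal_comp.mul_const Complex.I).cexp
  refine lipschitzWith_of_nnnorm_deriv_le (fun θ => (hd θ).differentiableAt) fun θ => ?_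
  rw [(hd θ).deriv, ← NNReal.coe_le_coe]
  simp

theorem exists_mem_angSet {γ : Set ℂ} (hγ : γ ⊆ uCircle) {x : ℂ} (hx : x ∈ γ) :
    ∃ θ ∈ angSet γ, Complex.exp (θ * Complex.I) = x := by
  have hx1 : ‖x‖ = 1 := by simpa [uCircle] using hγ hx
  obtain ⟨t, ht⟩ := (Complex.norm_eq_one_iff x).1 hx1
  have hperiod : Complex.exp ((toIcoMod Real.two_pi_pos 0 t : ℝ) * Complex.I) = x := by
    rw [← ht, Complex.exp_eq_exp_iff_exists_int]
    refine ⟨-toIcoDiv Real.two_pi_pos 0 t, ?_⟩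
    rw [toIcoMod]
    push_cast [zsmul_eq_mul]
    ring
  refine ⟨_, ⟨?_, ?_⟩, hperiod⟩
  · simpa using toIcoMod_mem_Ico Real.two_pi_pos 0 t
  · rwa [hperiod]

theorem norm_sub_le_of_volume_angSet_lt {γ : Set ℂ} (hc : IsPreconnected γ) (hγ : γ ⊆ uCircle)
    {r : ℝ} (hv : volume (angSet γ) < ENNReal.ofReal r) {ξ η : ℂ} (hξ : ξ ∈ γ) (hη : η ∈ γ) :
    ‖ξ - η‖ ≤ r := by
  have hr : 0 < r := ENNReal.ofReal_pos.1 (bot_le.trans_lt hv)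
  rcases eq_or_ne ξ η with rfl | hne
  · simpa using hr.le
  have hpos : 0 < ‖ξ - η‖ := norm_pos_iff.2 (sub_ne_zero.2 hne)
  set u : ℂ := (ξ - η) / ‖ξ - η‖ with hu
  have hu1 : ‖u‖ = 1 := by rw [hu, norm_div, norm_real, norm_norm, div_self hpos.ne']
  set L : ℂ → ℝ := fun x => (x * (starRingEnd ℂ) u).re with hL
  have hLlip : LipschitzWith 1 L := by
    refine LipschitzWith.of_dist_le_mul fun x y => ?_
    rw [Real.dist_eq, dist_eq_norm, hL, ← sub_re, ← sub_mul]
    refine (abs_re_le_norm _).trans ?_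
    simp [hu1]
  have hdiff : L ξ - L η = ‖ξ - η‖ := by
    simp only [hL]
    rw [← sub_re, ← sub_mul, hu, map_div₀, conj_ofReal, ← mul_div_assoc, mul_conj, normSq_eq_norm_sq,
      ← ofReal_div, ofReal_re]
    field_simp
  have hIcc : Icc (L η) (L ξ) ⊆ L '' γ :=
    (hc.image L hLlip.continuous.continuousOn).Icc_subset (mem_image_of_mem _ hη)
      (mem_image_of_mem _ hξ)
  have himg : L '' γ ⊆ (L ∘ fun θ : ℝ => Complex.exp (θ * Complex.I)) '' angSet γ := by
    rintro _ ⟨x, hx, rfl⟩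
    obtain ⟨θ, hθ, rfl⟩ := exists_mem_angSet hγ hx
    exact ⟨θ, hθ, rfl⟩
  have hvol := (hLlip.comp lipschitzWith_exp_ofReal_mul_I).hausdorffMeasure_image_le
    zero_le_one (angSet γ)
  rw [hausdorffMeasure_real] at hvol
  have h := (measure_mono (hIcc.trans himg)).trans_lt ((hvol.trans (by simp)).trans_lt hv)
  rw [Real.volume_Icc, hdiff, ENNReal.ofReal_lt_ofReal_iff hr] at h
  exact h.le

theorem norm_sub_le_of_mem_closure {E : Type*} [NormedAddCommGroup E] {S : Set E} {r : ℝ}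
    (h : ∀ x ∈ S, ∀ y ∈ S, ‖x - y‖ ≤ r) {x y : E} (hx : x ∈ closure S) (hy : y ∈ closure S) :
    ‖x - y‖ ≤ r := by
  have hcl : IsClosed {q : E × E | ‖q.1 - q.2‖ ≤ r} := isClosed_le (by fun_prop) (by fun_prop)
  have hsub : S ×ˢ S ⊆ {q : E × E | ‖q.1 - q.2‖ ≤ r} := fun q hq => h _ hq.1 _ hq.2
  have := closure_minimal hsub hcl
  rw [closure_prod_eq] at this
  exact this (mk_mem_prod hx hy)

theorem re_mul_conj_pos {x y : ℂ} (hx : ‖x‖ = 1) (hy : ‖y‖ = 1) (h : ‖x - y‖ ≤ 1 / 2) :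
    0 < (x * (starRingEnd ℂ) y).re := by
  have h1 : ‖x - y‖ ^ 2 = ‖x‖ ^ 2 + ‖y‖ ^ 2 - 2 * (x * (starRingEnd ℂ) y).re := by
    simp only [← normSq_eq_norm_sq, normSq_sub]
  rw [hx, hy] at h1
  nlinarith [norm_nonneg (x - y)]

theorem eq_div_norm_of_mul_conj {x q : ℂ} (hx : ‖x‖ = 1) (him : (x * (starRingEnd ℂ) q).im = 0)
    (hre : 0 < (x * (starRingEnd ℂ) q).re) : x = (‖q‖ : ℂ)⁻¹ * q := by
  have h1 : x * (starRingEnd ℂ) q = ((x * (starRingEnd ℂ) q).re : ℂ) :=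
    Complex.ext rfl (by simpa using him)
  have h2 : (x * (starRingEnd ℂ) q).re = ‖q‖ := by
    have h3 := congrArg norm h1
    rw [norm_real, Real.norm_of_nonneg hre.le] at h3
    rw [← h3, norm_mul, hx, RCLike.norm_conj, one_mul]
  rw [h2] at h1 hre
  have hq : (‖q‖ : ℂ) ≠ 0 := by exact_mod_cast hre.ne'
  have h4 : (starRingEnd ℂ) q * q = (‖q‖ : ℂ) ^ 2 := conj_mul' q
  rw [eq_inv_mul_iff_mul_eq₀ hq]
  apply mul_left_cancel₀ hq
  linear_combination q * h1 - x * h4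

theorem segment_mem_discSector {γ : Set ℂ} (hc : IsPreconnected γ) (hγ : γ ⊆ uCircle)
    (hd : ∀ x ∈ γ, ∀ y ∈ γ, ‖x - y‖ ≤ 1 / 2) {p z : ℂ} (hp1 : ‖p‖ = 1) (hp : p ∈ closure γ)
    (hpγ : p ∉ γ) (hz : z ∈ discSector γ) {s : ℝ} (hs0 : 0 < s) (hs1 : s ≤ 1) :
    (1 - s : ℝ) * p + (s : ℝ) * z ∈ discSector γ := by
  obtain ⟨hzd, hζ⟩ := hz
  have hz1 : ‖z‖ < 1 := by simpa [uDisc] using hzd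
  set ζ : ℂ := (‖z‖ : ℂ)⁻¹ * z with hζdef
  have hnorm : ∀ x ∈ insert p γ, ‖x‖ = 1 := by
    rintro x (rfl | hx)
    · exact hp1
    · simpa [uCircle] using hγ hx
  have hsub : insert p γ ⊆ closure γ := insert_subset hp subset_closure
  have hζS : ζ ∈ insert p γ := mem_insert_of_mem _ hζ
  have hm0 : 0 < ‖z‖ := by
    rw [norm_pos_iff]
    rintro rfl
    have := hnorm ζ hζS
    simp [hζdef] at this
  have hzζ : z = ‖z‖ * ζ := by
    rw [hζdef, mul_inv_cancel_left₀]
    exact_mod_cast hm0.ne'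
  set q : ℂ := (1 - s : ℝ) * p + (s : ℝ) * z with hq
  have hqx : ∀ x : ℂ, x * (starRingEnd ℂ) q =
      ((1 - s : ℝ) : ℂ) * (x * (starRingEnd ℂ) p) + ((s * ‖z‖ : ℝ) : ℂ) * (x * (starRingEnd ℂ) ζ) := by
    intro x
    rw [hq, hzζ]
    simp only [map_add, map_mul, conj_ofReal, ofReal_mul]
    rw [← hzζ]
    ring
  have hre : ∀ x ∈ insert p γ, 0 < (x * (starRingEnd ℂ) q).re := by
    intro x hx
    have h1 := re_mul_conj_pos (hnorm x hx) hp1 (norm_sub_le_of_mem_closure hd (hsub hx) hp)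
    have h2 := re_mul_conj_pos (hnorm x hx) (hnorm ζ hζS)
      (norm_sub_le_of_mem_closure hd (hsub hx) (hsub hζS))
    rw [hqx, add_re, re_ofReal_mul, re_ofReal_mul]
    have h3 : 0 < s * ‖z‖ := by positivity
    have h4 : 0 ≤ 1 - s := by linarith
    positivity
  have key : ∀ x ∈ insert p γ, (x * (starRingEnd ℂ) q).im = 0 → x = (‖q‖ : ℂ)⁻¹ * q :=
    fun x hx him => eq_div_norm_of_mul_conj (hnorm x hx) him (hre x hx)
  have hbal : (1 - s) * (p * (starRingEnd ℂ) q).im + s * ‖z‖ * (ζ * (starRingEnd ℂ) q).im = 0 := by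
    have h : q * (starRingEnd ℂ) q =
        ((1 - s : ℝ) : ℂ) * (p * (starRingEnd ℂ) q) + ((s * ‖z‖ : ℝ) : ℂ) * (ζ * (starRingEnd ℂ) q) := by
      nth_rewrite 1 [hq]
      nth_rewrite 1 [hzζ]
      push_cast
      ring
    have h' := congrArg Complex.im h
    rw [mul_conj, ofReal_im, add_im, im_ofReal_mul, im_ofReal_mul] at h'
    linarith
  have hsz : 0 < s * ‖z‖ := by positivity
  have hSconn : IsPreconnected (insert p γ) := hc.subset_closure (subset_insert _ _) hsub
  have hcont : ContinuousOn (fun x : ℂ => (x * (starRingEnd ℂ) q).im) (insert p γ) := by fun_prop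
  obtain ⟨x, hxS, hx0⟩ : ∃ x ∈ insert p γ, (x * (starRingEnd ℂ) q).im = 0 := by
    rcases le_total (p * (starRingEnd ℂ) q).im 0 with h | h
    · exact hSconn.intermediate_value (mem_insert _ _) hζS hcont ⟨h, by nlinarith⟩
    · exact hSconn.intermediate_value hζS (mem_insert _ _) hcont ⟨by nlinarith, h⟩
  have hqS : (‖q‖ : ℂ)⁻¹ * q ∈ insert p γ := key x hxS hx0 ▸ hxS
  refine ⟨?_, ?_⟩
  · simp only [uDisc, mem_ball_zero_iff]
    calc ‖q‖ ≤ ‖((1 - s : ℝ) : ℂ) * p‖ + ‖((s : ℝ) : ℂ) * z‖ := norm_add_le _ _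
      _ = (1 - s) + s * ‖z‖ := by
        rw [norm_mul, norm_mul, norm_real, norm_real, hp1, Real.norm_of_nonneg hs0.le,
          Real.norm_of_nonneg (by linarith), mul_one]
      _ < 1 := by nlinarith
  · rcases hqS with h | h
    · exfalso
      have hp0 : (p * (starRingEnd ℂ) q).im = 0 := by
        rw [← h, mul_assoc, mul_conj, ← ofReal_inv, ← ofReal_mul, ofReal_im]
      rw [hp0, mul_zero, zero_add] at hbal
      have := key ζ hζS ((mul_eq_zero.1 hbal).resolve_left hsz.ne')
      rw [h] at this
      exact hpγ (this ▸ hζ)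
    · exact h

theorem measurableSet_discSector {γ : Set ℂ} (hγ : MeasurableSet γ) :
    MeasurableSet (discSector γ) := by
  refine isOpen_ball.measurableSet.inter (?_ : MeasurableSet {z : ℂ | (‖z‖ : ℂ)⁻¹ * z ∈ γ})
  exact (by fun_prop : Measurable fun z : ℂ => (‖z‖ : ℂ)⁻¹ * z) hγ

theorem measurableSet_of_closure_eq_insert {γ : Set ℂ} {a b : ℂ} (ha : a ∉ γ) (hb : b ∉ γ)
    (h : closure γ = insert a (insert b γ)) : MeasurableSet γ := by
  have : γ = closure γ \ {a, b} := by
    rw [h]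
    ext x
    simp only [Set.mem_sdiff, mem_insert_iff, mem_singleton_iff]
    constructor
    · intro hx
      exact ⟨Or.inr (Or.inr hx), by rintro (rfl | rfl) <;> contradiction⟩
    · tauto
  rw [this]
  exact isClosed_closure.measurableSet.diff (by simp)

theorem sq_le_of_forall_le_mul_add_div {G A B : ℝ} (hG : 0 ≤ G) (hA : 0 < A) (hB : 0 ≤ B)
    (h : ∀ l > 0, G ≤ A * l + B / l) : G ^ 2 ≤ 4 * A * B := by
  rcases hG.eq_or_lt with rfl | hG
  · simp only [ne_eq, OfNat.ofNat_ne_zero, not_false_eq_true, zero_pow]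
    positivity
  have h1 := h (G / (2 * A)) (by positivity)
  have h2 : A * (G / (2 * A)) = G / 2 := by field_simp
  have h3 : B / (G / (2 * A)) = 2 * A * B / G := by field_simp
  rw [h2, h3] at h1
  have h4 : G / 2 ≤ 2 * A * B / G := by linarith
  rw [le_div_iff₀ hG] at h4
  nlinarith

theorem hasDerivAt_norm_rpow_comp {F : ℝ → ℂ} {F' : ℂ} {u ρ : ℝ} (hρ : 1 < ρ)
    (hF : HasDerivAt F F' u) :
    ∃ g', HasDerivAt (fun u => ‖F u‖ ^ ρ) g' u ∧ g' ≤ ρ * ‖F u‖ ^ (ρ - 1) * ‖F'‖ := by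
  refine ⟨_, (hasFDerivAt_norm_rpow (F u) hρ).comp_hasDerivAt u hF, ?_⟩
  have h1 : ‖F u‖ ^ (ρ - 1) = ‖F u‖ ^ (ρ - 2) * ‖F u‖ := by
    rw [← Real.rpow_add_one' (norm_nonneg _) (by linarith)]
    ring_nf
  rw [h1]
  simp only [_root_.smul_apply, innerSL_apply_apply, smul_eq_mul]
  rw [mul_assoc ρ, mul_assoc ρ, mul_assoc (‖F u‖ ^ (ρ - 2))]
  gcongr
  exact real_inner_le_norm _ _

theorem rpow_mul_le_of_pos {u D l σ : ℝ} (hu : 0 < u) (hl : 0 < l) :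
    u ^ σ * D ≤ l / 2 * u ^ (2 * σ - 1) + 1 / (2 * l) * (u * D ^ 2) := by
  have h1 : u ^ (2 * σ - 1) = (u ^ σ) ^ 2 / u := by
    rw [Real.rpow_sub_one hu.ne', two_mul, Real.rpow_add hu, sq]
  rw [h1, ← sub_nonneg]
  have h2 : l / 2 * ((u ^ σ) ^ 2 / u) + 1 / (2 * l) * (u * D ^ 2) - u ^ σ * D =
      (l * u ^ σ - u * D) ^ 2 / (2 * l * u) := by
    field_simp
    ring
  rw [h2]
  positivity

theorem norm_rpow_le_lintegral_ray {α ρ : ℝ} {f : ℂ → ℂ} (hα0 : 0 < α) (hα : α ≤ 1)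
    (hρ : 1 < ρ) (hf : MemA α f) (hn : ANorm α f ≤ 1) {p v : ℂ} (hp : ‖p‖ ≤ 1) (hfp : f p = 0)
    (hv : ‖v‖ = 1) {r : ℝ} (hr : 0 < r) (hseg : ∀ u ∈ Ioc 0 r, ‖p + (u : ℂ) * v‖ < 1) :
    ENNReal.ofReal (‖f (p + r * v)‖ ^ (2 * ρ)) ≤
      ENNReal.ofReal ((ρ * (2 / α + 1) ^ (ρ - 1)) ^ 2 * r ^ (2 * (α * (ρ - 1)))
        / (2 * (α * (ρ - 1)))) *
      ∫⁻ u in Ioc 0 r, ENNReal.ofReal (u * ‖deriv f (p + u * v)‖ ^ 2) := by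
  set σ := α * (ρ - 1) with hσ
  have hσ0 : 0 < σ := mul_pos hα0 (by linarith)
  have hC0 : 0 < 2 / α + 1 := by positivity
  set K := ρ * (2 / α + 1) ^ (ρ - 1) with hK
  have hK0 : 0 < K := mul_pos (by linarith) (Real.rpow_pos_of_pos hC0 _)
  set e0 : ℝ → ℝ := fun u => u * ‖deriv f (p + u * v)‖ ^ 2 with he0
  have hmeas : Measurable e0 := by
    have h := (measurable_deriv f).comp (by fun_prop : Measurable fun u : ℝ => p + u * v)
    exact measurable_id.mul (h.norm.pow_const 2)
  have hnonneg : 0 ≤ᵐ[volume.restrict (Ioc 0 r)] e0 :=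
    ae_restrict_of_forall_mem measurableSet_Ioc fun u hu => mul_nonneg hu.1.le (by positivity)
  by_cases htop : ∫⁻ u in Ioc 0 r, ENNReal.ofReal (e0 u) = ⊤
  · rw [htop, ENNReal.mul_top]
    · exact le_top
    · rw [Ne, ENNReal.ofReal_eq_zero, not_le]
      positivity
  have hint : IntegrableOn e0 (Ioc 0 r) :=
    (lintegral_ofReal_ne_top_iff_integrable hmeas.aestronglyMeasurable hnonneg).1 htop
  rw [← ofReal_integral_eq_lintegral_ofReal hint hnonneg, ← ENNReal.ofReal_mul (by positivity)]
  apply ENNReal.ofReal_le_ofReal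
  set e := ∫ u in Ioc 0 r, e0 u with he
  have hee : 0 ≤ e := setIntegral_nonneg_of_ae_restrict hnonneg
  have hmem : ∀ u ∈ Icc 0 r, ‖p + (u : ℂ) * v‖ ≤ 1 := by
    intro u hu
    rcases hu.1.eq_or_lt with h | h
    · simpa [← h] using hp
    · exact (hseg u ⟨h, hu.2⟩).le
  have key : ∀ l > 0, ‖f (p + r * v)‖ ^ ρ ≤ K * r ^ (2 * σ) / (4 * σ) * l + K * e / 2 / l := by
    intro l hl
    have hd : ∀ u ∈ Ioo 0 r, ∃ g', HasDerivAt (fun u : ℝ => ‖f (p + u * v)‖ ^ ρ) g' u ∧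
        g' ≤ K * (l / 2 * u ^ (2 * σ - 1) + 1 / (2 * l) * e0 u) := by
      intro u hu
      have hin : p + (u : ℂ) * v ∈ uDisc := by
        simpa [uDisc] using hseg u ⟨hu.1, hu.2.le⟩
      have h1 : HasDerivAt f (deriv f (p + u * v)) (p + u * v) :=
        (hf.1.1.differentiableAt (isOpen_ball.mem_nhds hin)).hasDerivAt
      have h2 : HasDerivAt (fun u : ℝ => p + (u : ℂ) * v) v u := by
        simpa using ((hasDerivAt_id u).ofReal_comp.mul_const v).const_add p
      obtain ⟨g', hg', hle⟩ := hasDerivAt_norm_rpow_comp hρ (h1.comp u h2)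
      refine ⟨g', hg', hle.trans ?_⟩
      simp only [Function.comp_apply]
      have h3 := norm_le_mul_dist_rpow hα0 hα hf hn hp (hmem u ⟨hu.1.le, hu.2.le⟩) hfp
      rw [add_sub_cancel_left, norm_mul, hv, mul_one, norm_real, Real.norm_of_nonneg hu.1.le] at h3
      rw [norm_mul, hv, mul_one]
      calc ρ * ‖f (p + u * v)‖ ^ (ρ - 1) * ‖deriv f (p + u * v)‖
          ≤ ρ * ((2 / α + 1) * u ^ α) ^ (ρ - 1) * ‖deriv f (p + u * v)‖ := by gcongr
        _ = K * (u ^ σ * ‖deriv f (p + u * v)‖) := by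
          rw [Real.mul_rpow hC0.le (by have := hu.1; positivity), ← Real.rpow_mul hu.1.le, hK]
          ring
        _ ≤ _ := by
          gcongr
          exact rpow_mul_le_of_pos hu.1 hl
    choose! g' hg' hle using hd
    have hpow : IntervalIntegrable (fun u : ℝ => u ^ (2 * σ - 1)) volume 0 r :=
      intervalIntegral.intervalIntegrable_rpow' (by linarith)
    have he0int : IntervalIntegrable e0 volume 0 r :=
      (intervalIntegrable_iff_integrableOn_Ioc_of_le hr.le).2 hint
    have hφ := ((hpow.const_mul (l / 2)).add (he0int.const_mul (1 / (2 * l)))).const_mul K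
    have hmain := intervalIntegral.sub_le_integral_of_hasDeriv_right_of_le hr.le
      (g := fun u : ℝ => ‖f (p + u * v)‖ ^ ρ) ?_ (fun u hu => (hg' u hu).hasDerivWithinAt)
      ((intervalIntegrable_iff_integrableOn_Icc_of_le hr.le).1 hφ) hle
    · rw [intervalIntegral.integral_const_mul, intervalIntegral.integral_add (hpow.const_mul _)
        (he0int.const_mul _), intervalIntegral.integral_const_mul,
        intervalIntegral.integral_const_mul, integral_rpow (Or.inl (by linarith)),
        intervalIntegral.integral_of_le hr.le, ← he, sub_add_cancel,
        Real.zero_rpow (by positivity)] at hmain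
      simp only [ofReal_zero, zero_mul, add_zero, hfp, norm_zero,
        Real.zero_rpow (by positivity : ρ ≠ 0), sub_zero] at hmain
      refine hmain.trans_eq ?_
      field_simp
      ring
    · refine ContinuousOn.rpow_const (hf.2.1.2.comp (by fun_prop) fun u hu => ?_).norm
        fun _ _ => Or.inr (by linarith)
      simpa using hmem u hu
  have hfin := sq_le_of_forall_le_mul_add_div (by positivity) (by positivity) (by positivity) key
  have h2ρ : ‖f (p + r * v)‖ ^ (2 * ρ) = (‖f (p + r * v)‖ ^ ρ) ^ 2 := by
    rw [mul_comm 2 ρ, Real.rpow_mul (norm_nonneg _), Real.rpow_two]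
  rw [h2ρ]
  refine hfin.trans_eq ?_
  field_simp

theorem lintegral_eq_lintegral_polar (p : ℂ) {g : ℂ → ℝ≥0∞} (hg : Measurable g) :
    ∫⁻ z, g z = ∫⁻ ψ in Ioo (-Real.pi) Real.pi, ∫⁻ r in Ioi (0 : ℝ),
      ENNReal.ofReal r * g (p + r * Complex.exp (ψ * Complex.I)) := by
  rw [← lintegral_add_left_eq_self g p, ← Complex.lintegral_comp_polarCoord_symm,
    polarCoord_target, Measure.volume_eq_prod, ← Measure.prod_restrict]
  have h : ∀ q : ℝ × ℝ, ENNReal.ofReal q.1 • g (p + Complex.polarCoord.symm q) =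
      ENNReal.ofReal q.1 * g (p + q.1 * Complex.exp (q.2 * Complex.I)) := by
    intro q
    rw [Complex.polarCoord_symm_apply, smul_eq_mul, Complex.exp_mul_I]
    push_cast
    rfl
  simp only [h]
  rw [lintegral_prod_symm']
  fun_prop

theorem abs_log_le_of_le_two {σ r : ℝ} (hσ0 : 0 < σ) (hσ1 : σ ≤ 1) (hr0 : 0 < r) (hr2 : r ≤ 2) :
    |Real.log r| * r ^ (σ / 2) ≤ 2 / σ := by
  have h2σ : 2 ≤ 2 / σ := by rw [le_div_iff₀ hσ0]; linarith
  rcases le_total r 1 with h | h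
  · have := (Real.abs_log_mul_self_rpow_lt r (σ / 2) hr0 h (by positivity)).le
    rw [abs_mul, abs_of_pos (Real.rpow_pos_of_pos hr0 _)] at this
    refine this.trans_eq ?_
    field_simp
  · have h1 : |Real.log r| ≤ 1 := by
      rw [abs_of_nonneg (Real.log_nonneg h)]
      linarith [Real.log_le_sub_one_of_pos hr0]
    have h3 : r ^ (σ / 2) ≤ 2 := by
      calc r ^ (σ / 2) ≤ r ^ (1 : ℝ) := Real.rpow_le_rpow_of_exponent_le h (by linarith)
        _ ≤ 2 := by simpa using hr2
    calc |Real.log r| * r ^ (σ / 2) ≤ 1 * 2 := by gcongr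
      _ ≤ 2 / σ := by linarith

/-- The weight produced by the estimate along rays is controlled by an integrable power. -/
theorem mul_sq_log_div_mul_rpow_le {σ r : ℝ} (hσ0 : 0 < σ) (hσ1 : σ ≤ 1) (hr0 : 0 < r)
    (hr2 : r ≤ 2) :
    r * (|Real.log r| / r) ^ 2 * r ^ (2 * σ) ≤ (2 / σ) ^ 2 * r ^ (σ - 1) := by
  have h1 := abs_log_le_of_le_two hσ0 hσ1 hr0 hr2
  have h2 : r ^ (2 * σ) = (r ^ (σ / 2)) ^ 2 * r ^ (σ - 1) * r := by
    rw [← Real.rpow_two, ← Real.rpow_mul hr0.le, ← Real.rpow_add hr0,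
      ← Real.rpow_add_one hr0.ne']
    ring_nf
  rw [h2]
  calc r * (|Real.log r| / r) ^ 2 * ((r ^ (σ / 2)) ^ 2 * r ^ (σ - 1) * r)
      = (|Real.log r| * r ^ (σ / 2)) ^ 2 * r ^ (σ - 1) := by
        field_simp
    _ ≤ _ := by gcongr

theorem measurable_weight {f : ℂ → ℂ} (hf : DifferentiableOn ℂ f uDisc) (p : ℂ) (ρ k : ℝ) :
    Measurable fun z =>
      ‖uDisc.indicator f z‖ ^ (2 * ρ) * (k * (|Real.log ‖z - p‖| / ‖z - p‖)) ^ 2 := by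
  have hfm : Measurable (uDisc.indicator f) := by
    rw [← piecewise_eq_indicator]
    exact hf.continuousOn.measurable_piecewise continuousOn_const isOpen_ball.measurableSet
  have h1 : Measurable fun z : ℂ => ‖z - p‖ := by fun_prop
  have h2 : Measurable fun z : ℂ => |Real.log ‖z - p‖| :=
    (Real.measurable_log.comp h1).abs
  exact (hfm.norm.pow_const _).mul (((h2.div h1).const_mul k).pow_const 2)

theorem exists_lintegral_endpoint_le {α ρ : ℝ} (hα0 : 0 < α) (hα : α ≤ 1) (hρ : 1 < ρ)
    (hσ1 : α * (ρ - 1) ≤ 1) (k : ℝ) :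
    ∃ C : ℝ≥0∞, C ≠ ⊤ ∧ ∀ (f : ℂ → ℂ) (p : ℂ) (Δ : Set ℂ), MemA α f → ANorm α f ≤ 1 →
      ‖p‖ ≤ 1 → f p = 0 → MeasurableSet Δ → Δ ⊆ uDisc →
      (∀ z ∈ Δ, ∀ s : ℝ, 0 < s → s ≤ 1 → ((1 - s : ℝ) : ℂ) * p + (s : ℂ) * z ∈ Δ) →
      ∫⁻ z in Δ, ENNReal.ofReal
          (‖uDisc.indicator f z‖ ^ (2 * ρ) * (k * (|Real.log ‖z - p‖| / ‖z - p‖)) ^ 2) ≤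
        C * ∫⁻ z in Δ, ENNReal.ofReal (‖deriv f z‖ ^ 2) := by
  set σ := α * (ρ - 1) with hσ
  have hσ0 : 0 < σ := mul_pos hα0 (by linarith)
  set K := (ρ * (2 / α + 1) ^ (ρ - 1)) ^ 2 with hK
  have hK0 : 0 ≤ K := by positivity
  set c := K / (2 * σ) * k ^ 2 * (2 / σ) ^ 2 with hc
  have hc0 : 0 ≤ c := by positivity
  set w : ℝ → ℝ≥0∞ := (Ioc (0 : ℝ) 2).indicator fun r => ENNReal.ofReal (c * r ^ (σ - 1)) with hw
  have hwm : Measurable w := by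
    refine Measurable.indicator ?_ measurableSet_Ioc
    fun_prop
  have hfin : ∫⁻ r, w r ≠ ⊤ := by
    rw [hw, lintegral_indicator measurableSet_Ioc]
    have hint : IntegrableOn (fun r : ℝ => c * r ^ (σ - 1)) (Ioc 0 2) :=
      (intervalIntegrable_iff_integrableOn_Ioc_of_le two_pos.le).1
        ((intervalIntegral.intervalIntegrable_rpow' (by linarith)).const_mul c)
    exact hint.lintegral_lt_top.ne
  refine ⟨∫⁻ r, w r, hfin, ?_⟩
  intro f p Δ hf hn hp hfp hΔ hΔD hstar
  set h : ℂ → ℝ := fun z =>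
    ‖uDisc.indicator f z‖ ^ (2 * ρ) * (k * (|Real.log ‖z - p‖| / ‖z - p‖)) ^ 2 with hh
  have hhm : Measurable h := measurable_weight hf.1.1 p ρ k
  set H : ℂ → ℝ≥0∞ := Δ.indicator fun z => ENNReal.ofReal (h z) with hH
  set G : ℂ → ℝ≥0∞ := Δ.indicator fun z => ENNReal.ofReal (‖deriv f z‖ ^ 2) with hG
  have hHm : Measurable H := hhm.ennreal_ofReal.indicator hΔ
  have hGm : Measurable G :=
    ((measurable_deriv f).norm.pow_const 2).ennreal_ofReal.indicator hΔ
  rw [← lintegral_indicator hΔ, ← lintegral_indicator hΔ, lintegral_eq_lintegral_polar p hHm,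
    lintegral_eq_lintegral_polar p hGm, ← lintegral_const_mul' _ _ hfin]
  refine lintegral_mono fun ψ => ?_
  set v := Complex.exp (ψ * Complex.I) with hv
  have hv1 : ‖v‖ = 1 := Complex.norm_exp_ofReal_mul_I ψ
  set E := ∫⁻ r in Ioi (0 : ℝ), ENNReal.ofReal r * G (p + r * v) with hE
  have hptw : ∀ r ∈ Ioi (0 : ℝ), ENNReal.ofReal r * H (p + r * v) ≤ w r * E := by
    intro r hr
    rw [mem_Ioi] at hr
    by_cases hz : p + r * v ∈ Δ
    swap
    · simp [hH, hz]
    have hnorm : ‖(r : ℂ) * v‖ = r := by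
      rw [norm_mul, hv1, mul_one, norm_real, Real.norm_of_nonneg hr.le]
    have hz1 : ‖p + r * v‖ < 1 := by simpa [uDisc] using hΔD hz
    have hr2 : r ≤ 2 := by
      have := norm_sub_le (p + r * v) p
      rw [add_sub_cancel_left, hnorm] at this
      linarith
    have hseg : ∀ u ∈ Ioc 0 r, p + (u : ℂ) * v ∈ Δ := by
      intro u hu
      have := hstar _ hz (u / r) (div_pos hu.1 hr) ((div_le_one hr).2 hu.2)
      convert this using 1
      have : (r : ℂ) ≠ 0 := by exact_mod_cast hr.ne'
      push_cast
      field_simp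
      ring
    have hray := norm_rpow_le_lintegral_ray hα0 hα hρ hf hn hp hfp hv1 hr
      fun u hu => by simpa [uDisc] using hΔD (hseg u hu)
    have hle : ∫⁻ u in Ioc 0 r, ENNReal.ofReal (u * ‖deriv f (p + u * v)‖ ^ 2) ≤ E := by
      calc _ = ∫⁻ u in Ioc 0 r, ENNReal.ofReal u * G (p + u * v) := by
            refine setLIntegral_congr_fun measurableSet_Ioc fun u hu => ?_
            simp only [hG, indicator_of_mem (hseg u hu)]
            rw [ENNReal.ofReal_mul hu.1.le]
        _ ≤ E := lintegral_mono_set Ioc_subset_Ioi_self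
    have hH' : H (p + r * v) = ENNReal.ofReal (‖f (p + r * v)‖ ^ (2 * ρ)) *
        ENNReal.ofReal ((k * (|Real.log r| / r)) ^ 2) := by
      simp only [hH, indicator_of_mem hz, hh]
      rw [indicator_of_mem (hΔD hz), add_sub_cancel_left, hnorm,
        ENNReal.ofReal_mul (by positivity)]
    have hwr : w r = ENNReal.ofReal (c * r ^ (σ - 1)) := by
      simp only [hw]
      exact indicator_of_mem (show r ∈ Ioc 0 2 from ⟨hr, hr2⟩) _
    rw [hH', hwr]
    calc ENNReal.ofReal r * (ENNReal.ofReal (‖f (p + r * v)‖ ^ (2 * ρ)) *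
          ENNReal.ofReal ((k * (|Real.log r| / r)) ^ 2))
        ≤ ENNReal.ofReal r * (ENNReal.ofReal (K * r ^ (2 * σ) / (2 * σ)) * E *
          ENNReal.ofReal ((k * (|Real.log r| / r)) ^ 2)) := by
          gcongr
          exact hray.trans (by gcongr)
      _ = ENNReal.ofReal (r * (K * r ^ (2 * σ) / (2 * σ)) * (k * (|Real.log r| / r)) ^ 2) * E := by
          rw [ENNReal.ofReal_mul (by positivity), ENNReal.ofReal_mul hr.le]
          ring
      _ ≤ _ := by
          gcongr ENNReal.ofReal ?_ * E
          have := mul_le_mul_of_nonneg_left (mul_sq_log_div_mul_rpow_le hσ0 hσ1 hr hr2)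
            (by positivity : 0 ≤ K / (2 * σ) * k ^ 2)
          calc _ = K / (2 * σ) * k ^ 2 * (r * (|Real.log r| / r) ^ 2 * r ^ (2 * σ)) := by ring
            _ ≤ _ := this
            _ = _ := by rw [hc]; ring
  calc ∫⁻ r in Ioi (0 : ℝ), ENNReal.ofReal r * H (p + r * v)
      ≤ ∫⁻ r in Ioi (0 : ℝ), w r * E := setLIntegral_mono' measurableSet_Ioi hptw
    _ ≤ ∫⁻ r, w r * E := setLIntegral_le_lintegral _ _
    _ = (∫⁻ r, w r) * E := lintegral_mul_const _ hwm

theorem aFun_nonneg {α : ℝ} {f : ℂ → ℂ} (hf : MemA α f) (hn : ANorm α f ≤ 1) (Γ γ : Set ℂ)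
    (z : ℂ) : 0 ≤ aFun f Γ γ z := by
  refine mul_nonneg (by positivity) (integral_nonneg fun θ => div_nonneg ?_ (by positivity))
  rw [neg_nonneg]
  refine Real.log_nonpos (norm_nonneg _) (norm_le_one_of_ANorm_le_one hf hn ?_)
  simp [Complex.norm_exp_ofReal_mul_I]

/-- `∫_{Δ_γ²¹} |f|^{2ρ} a_γ² dA ≤ C_ρ ‖f'‖²_{L²(Δ_γ)}`. -/
theorem sector21_est (α ρ : ℝ) (hα0 : 0 < α) (hα1 : α ≤ 1/2) (hρ1 : 1 < ρ) (hρ2 : ρ ≤ 2) :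
    ∃ C : ℝ, 0 < C ∧ ∀ (f : ℂ → ℂ) (Γ γ : Set ℂ) (a b : ℂ),
      MemA α f → IsOuter f → ANorm α f ≤ 1 → IsArcUnion f Γ →
      IsCompArc f γ → volume (angSet γ) < ENNReal.ofReal (1/2) →
      a ∈ bZeros f → b ∈ bZeros f → closure γ = insert a (insert b γ) →
      nlint (sector21 f Γ γ a b)
          (fun z => ‖f z‖ ^ (2 * ρ) * (aFun f Γ γ z) ^ 2) ≤
        ENNReal.ofReal C * nlint (discSector γ) (fun z => ‖deriv f z‖ ^ 2) := by
  have hα : α ≤ 1 := by linarith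
  obtain ⟨C, hC, hmain⟩ := exists_lintegral_endpoint_le hα0 hα hρ1 (by nlinarith) 8
  refine ⟨2 * C.toReal + 1, by positivity, ?_⟩
  intro f Γ γ a b hf _ hn _ hγ hv ha hb hcl
  obtain ⟨x, _, hγx⟩ := hγ
  have hc : IsPreconnected γ := hγx ▸ isPreconnected_connectedComponentIn
  have hγo : γ ⊆ offZeros f := hγx ▸ connectedComponentIn_subset _ _
  have hγu : γ ⊆ uCircle := fun z hz => (hγo hz).1
  have hend : ∀ p ∈ bZeros f, p ∈ closure γ → ‖p‖ = 1 ∧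
      ∀ z ∈ discSector γ, ∀ s : ℝ, 0 < s → s ≤ 1 →
        ((1 - s : ℝ) : ℂ) * p + (s : ℂ) * z ∈ discSector γ := by
    intro p hp hpc
    have hp1 : ‖p‖ = 1 := by simpa [uCircle] using hp.1
    exact ⟨hp1, fun z hz s hs0 hs1 => segment_mem_discSector hc hγu
      (fun x hx y hy => norm_sub_le_of_volume_angSet_lt hc hγu hv hx hy) hp1 hpc
      (fun h => (hγo h).2 hp.2) hz hs0 hs1⟩
  obtain ⟨ha1, hsa⟩ := hend a ha (by simp [hcl])
  obtain ⟨hb1, hsb⟩ := hend b hb (by simp [hcl])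
  have hΔ : MeasurableSet (discSector γ) := measurableSet_discSector <|
    measurableSet_of_closure_eq_insert (fun h => (hγo h).2 ha.2) (fun h => (hγo h).2 hb.2) hcl
  have hΔD : discSector γ ⊆ uDisc := fun z hz => hz.1
  set w : ℂ → ℂ → ℝ := fun p z =>
    ‖uDisc.indicator f z‖ ^ (2 * ρ) * (8 * (|Real.log ‖z - p‖| / ‖z - p‖)) ^ 2 with hw
  have hwm : ∀ p, Measurable fun z => ENNReal.ofReal (w p z) := fun p =>
    (measurable_weight hf.1.1 p ρ 8).ennreal_ofReal
  have hA := hmain f a _ hf hn ha1.le ha.2 hΔ hΔD hsa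
  have hB := hmain f b _ hf hn hb1.le hb.2 hΔ hΔD hsb
  have hptw : ∀ z ∈ sector21 f Γ γ a b,
      ENNReal.ofReal (‖f z‖ ^ (2 * ρ) * (aFun f Γ γ z) ^ 2) ≤
        ENNReal.ofReal (w a z) + ENNReal.ofReal (w b z) := by
    intro z hz
    have hle : ∀ p, dd a b z = ‖z - p‖ →
        ENNReal.ofReal (‖f z‖ ^ (2 * ρ) * (aFun f Γ γ z) ^ 2) ≤ ENNReal.ofReal (w p z) := by
      intro p hp
      have h1 := hz.2
      rw [hp, mul_div_assoc] at h1
      have h0 := aFun_nonneg hf hn Γ γ z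
      simp only [hw]
      rw [indicator_of_mem (hΔD hz.1.1)]
      gcongr
    rcases min_choice ‖z - a‖ ‖z - b‖ with h | h
    · exact (hle a h).trans le_self_add
    · exact (hle b h).trans le_add_self
  set I := ∫⁻ z in discSector γ, ENNReal.ofReal (‖deriv f z‖ ^ 2) with hI
  have hint : ∫⁻ z in sector21 f Γ γ a b,
      ENNReal.ofReal (‖f z‖ ^ (2 * ρ) * (aFun f Γ γ z) ^ 2) ≤
        ENNReal.ofReal (2 * C.toReal + 1) * I := by
    calc _ ≤ ∫⁻ z in sector21 f Γ γ a b, (ENNReal.ofReal (w a z) + ENNReal.ofReal (w b z)) :=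
          setLIntegral_mono ((hwm a).add (hwm b)) hptw
      _ ≤ ∫⁻ z in discSector γ, (ENNReal.ofReal (w a z) + ENNReal.ofReal (w b z)) :=
          lintegral_mono_set fun z hz => hz.1.1
      _ = (∫⁻ z in discSector γ, ENNReal.ofReal (w a z)) +
          ∫⁻ z in discSector γ, ENNReal.ofReal (w b z) := lintegral_add_left (hwm a) _
      _ ≤ C * I + C * I := add_le_add hA hB
      _ = 2 * C * I := by ring
      _ ≤ ENNReal.ofReal (2 * C.toReal + 1) * I := by
          gcongr
          rw [ENNReal.ofReal_add (by positivity) one_pos.le, ENNReal.ofReal_mul two_pos.le,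
            ENNReal.ofReal_toReal hC]
          simp
  calc nlint (sector21 f Γ γ a b) _ ≤
        ENNReal.ofReal (1 / Real.pi) * (ENNReal.ofReal (2 * C.toReal + 1) * I) := by
        unfold nlint
        gcongr
    _ = _ := by
        unfold nlint
        ring
end

section
/- Let 0 < α ≤ 1/2, let f ∈ 𝒜_α be outer with ‖f‖_{𝒜_α} ≤ 1, let Γ be a union of component arcs of 𝕋\E_f, and let γ = (a,b) be a component arc of 𝕋\E_f of arclength < 1/2, with d(z) ≤ 1/2 for z ∈ Δ_γ². Then for every z ∈ Δ_γ²², setting μ_z := 1 − 8|log d(z)|/a_γ(z), one has |f(μ_z z)| ≤ d(z)². -/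
open Complex MeasureTheory Set Metric Filter
open scoped ENNReal Classical

/-- A boundary point outside the component arc `γ = (a,b)` is at least as far from a point of the
sector over `γ` as the nearer endpoint. -/
lemma dd_le_norm_sub_of_notMem {f : ℂ → ℂ} {γ : Set ℂ} {a b z w : ℂ} (hf : IsDiscReg f)
    (hγ : IsCompArc f γ) (hclo : closure γ = insert a (insert b γ))
    (hz : z ∈ discSector γ) (hw : w ∈ uCircle) (hwγ : w ∉ γ) : dd a b z ≤ ‖w - z‖ := by
  obtain ⟨x, hx, rfl⟩ := hγ
  set ζ : ℂ := ((‖z‖ : ℂ))⁻¹ * z with hζ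
  have hζγ : ζ ∈ connectedComponentIn (offZeros f) x := hz.2
  have hζ1 : ‖ζ‖ = 1 := by
    simpa [uCircle] using (connectedComponentIn_subset _ _ hζγ).1
  have hz0 : ‖z‖ ≠ 0 := by
    intro h
    simp [hζ, h] at hζ1
  have hzζ : z = ζ * (‖z‖ : ℂ) := by
    rw [hζ]
    have : (‖z‖ : ℂ) ≠ 0 := by exact_mod_cast hz0
    field_simp
  have hw1 : ‖w‖ = 1 := by simpa [uCircle] using hw
  have hζ0 : ζ ≠ 0 := by
    rintro h
    simp [h] at hζ1
  set ψ : ℝ := (w / ζ).arg with hψ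
  have hwψ : w = ζ * exp ((ψ : ℂ) * I) := by
    have h := norm_mul_exp_arg_mul_I (w / ζ)
    rw [norm_div, hw1, hζ1] at h
    simp only [div_one, ofReal_one, one_mul] at h
    rw [hψ, h]
    field_simp
  set s : ℝ → ℂ := fun t => ζ * exp (((t * ψ : ℝ) : ℂ) * I) with hs
  have hscont : Continuous s := by fun_prop
  have hsnorm : ∀ t, ‖s t‖ = 1 := fun t => by
    simp only [hs, norm_mul, hζ1, norm_exp_ofReal_mul_I, one_mul]
  have hs0 : s 0 = ζ := by simp [hs]
  have hs1 : s 1 = w := by simp [hs, ← hwψ]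
  have hdist : ∀ t, ‖s t - z‖ ^ 2 = 1 - 2 * ‖z‖ * Real.cos (t * ψ) + ‖z‖ ^ 2 := by
    intro t
    have h : s t - z = ζ * (exp (((t * ψ : ℝ) : ℂ) * I) - (‖z‖ : ℂ)) := by
      rw [mul_sub, ← hzζ]
    rw [h, norm_mul, hζ1, one_mul, ← normSq_eq_norm_sq, normSq_apply]
    simp only [sub_re, sub_im, exp_ofReal_mul_I_re, exp_ofReal_mul_I_im, ofReal_re, ofReal_im]
    nlinarith [Real.sin_sq_add_cos_sq (t * ψ)]
  have hmono : ∀ t ∈ Icc (0 : ℝ) 1, ‖s t - z‖ ≤ ‖w - z‖ := by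
    intro t ht
    have hcos : Real.cos ψ ≤ Real.cos (t * ψ) := by
      rw [← Real.cos_abs ψ, ← Real.cos_abs (t * ψ), abs_mul, abs_of_nonneg ht.1]
      refine Real.cos_le_cos_of_nonneg_of_le_pi (by have := ht.1; positivity) (abs_arg_le_pi _) ?_
      exact mul_le_of_le_one_left (abs_nonneg _) ht.2
    rw [← hs1]
    refine le_of_sq_le_sq ?_ (norm_nonneg _)
    rw [hdist, hdist, one_mul]
    nlinarith [mul_le_mul_of_nonneg_left hcos (norm_nonneg z)]
  by_contra! hlt
  have hend : ∀ t ∈ Icc (0 : ℝ) 1, s t ≠ a ∧ s t ≠ b := by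
    intro t ht
    have h := (hmono t ht).trans_lt hlt
    constructor <;> rintro h'
    · rw [h', norm_sub_rev] at h
      exact absurd (min_le_left ‖z - a‖ ‖z - b‖) (not_le.2 h)
    · rw [h', norm_sub_rev] at h
      exact absurd (min_le_right ‖z - a‖ ‖z - b‖) (not_le.2 h)
  have hfs : Continuous fun t => f (s t) :=
    hf.2.comp_continuous hscont fun t => by simp [hsnorm]
  have hsub : Icc (0 : ℝ) 1 ⊆ s ⁻¹' connectedComponentIn (offZeros f) x := by
    refine IsClosed.Icc_subset_of_forall_exists_gt ?_ (by simpa [hs0] using hζγ) ?_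
    · have h : s ⁻¹' connectedComponentIn (offZeros f) x ∩ Icc 0 1 =
          s ⁻¹' closure (connectedComponentIn (offZeros f) x) ∩ Icc 0 1 := by
        ext t
        rw [hclo]
        constructor
        · rintro ⟨h1, h2⟩
          exact ⟨Or.inr (Or.inr h1), h2⟩
        · rintro ⟨h1, h2⟩
          refine ⟨?_, h2⟩
          rcases h1 with h1 | h1 | h1
          · exact absurd h1 (hend t h2).1
          · exact absurd h1 (hend t h2).2
          · exact h1
      rw [h]
      exact (isClosed_closure.preimage hscont).inter isClosed_Icc
    · rintro t ⟨htγ, -⟩ y hy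
      have hft : f (s t) ≠ 0 := (connectedComponentIn_subset _ _ htγ).2
      obtain ⟨δ, hδ, hball⟩ := Metric.eventually_nhds_iff.1
        (hfs.continuousAt.eventually_ne hft)
      have hy' : t < y := hy
      have htu : t < min y (t + δ / 2) := lt_min hy' (by linarith)
      refine ⟨min y (t + δ / 2), ?_, htu, min_le_left _ _⟩
      have hpre : IsPreconnected (s '' Icc t (min y (t + δ / 2))) :=
        isPreconnected_Icc.image _ hscont.continuousOn
      have hsubset : s '' Icc t (min y (t + δ / 2)) ⊆ offZeros f := by
        rintro _ ⟨v, hv, rfl⟩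
        refine ⟨by simp [uCircle, hsnorm], hball ?_⟩
        rw [Real.dist_eq, abs_of_nonneg (by linarith [hv.1])]
        linarith [hv.2.trans (min_le_right _ _)]
      have h := hpre.subset_connectedComponentIn ⟨t, left_mem_Icc.2 htu.le, rfl⟩ hsubset
      rw [← connectedComponentIn_eq htγ] at h
      exact h ⟨_, right_mem_Icc.2 htu.le, rfl⟩
  exact hwγ (hs1 ▸ hsub (right_mem_Icc.2 zero_le_one))

/-- The set `Λ_γ` lies on the circle and is disjoint from `γ`. -/
lemma lamSet_subset {f : ℂ → ℂ} {Γ γ : Set ℂ} (hΓ : IsArcUnion f Γ) (hγ : IsCompArc f γ) :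
    lamSet Γ γ ⊆ uCircle \ γ := by
  intro w hw
  unfold lamSet at hw
  split_ifs at hw with h
  · exact ⟨hw.1, fun h' => hw.2 (h h')⟩
  · refine ⟨(hΓ.1 hw).1, fun h' => h ?_⟩
    obtain ⟨x, hx, rfl⟩ := hγ
    rw [connectedComponentIn_eq h']
    exact hΓ.2 w hw

/-- A function in the unit ball of `𝒜_α` is bounded by `1` on the closed disc. -/
lemma norm_le_one_of_ANorm_le_one_s13 {α : ℝ} {f : ℂ → ℂ} (hf : IsDiscReg f) (hnorm : ANorm α f ≤ 1)
    {w : ℂ} (hw : w ∈ closedBall (0 : ℂ) 1) : ‖f w‖ ≤ 1 := by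
  have hsup : supNorm f ≤ 1 := by
    have h1 : 0 ≤ sSup ((fun z => (1 - ‖z‖) ^ (1 - α) * ‖deriv f z‖) '' uDisc) := by
      refine Real.sSup_nonneg ?_
      rintro _ ⟨z, hz, rfl⟩
      have : ‖z‖ < 1 := by simpa [uDisc] using hz
      exact mul_nonneg (Real.rpow_nonneg (by linarith) _) (norm_nonneg _)
    have h2 := Real.sqrt_nonneg (dirInt f)
    unfold ANorm lipNorm at hnorm
    linarith
  have hbdd : BddAbove ((fun z => ‖f z‖) '' uDisc) :=
    ((isCompact_closedBall (0 : ℂ) 1).bddAbove_image hf.2.norm).mono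
      (image_mono ball_subset_closedBall)
  have hdisc : ∀ z ∈ uDisc, ‖f z‖ ≤ 1 := fun z hz =>
    (le_csSup hbdd ⟨z, hz, rfl⟩).trans hsup
  have hcl : closure uDisc = closedBall (0 : ℂ) 1 := closure_ball 0 one_ne_zero
  rw [← hcl] at hw
  exact le_on_closure hdisc (hcl ▸ hf.2.norm) continuousOn_const hw

lemma circleKernel_re (z : ℂ) (θ : ℝ) :
    (circleKernel z θ).re = (1 - ‖z‖ ^ 2) / ‖exp ((θ : ℂ) * I) - z‖ ^ 2 := by
  have h : normSq (exp ((θ : ℂ) * I)) = 1 := by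
    rw [normSq_eq_norm_sq, norm_exp_ofReal_mul_I, one_pow]
  rw [circleKernel, div_re, ← add_div, ← normSq_eq_norm_sq, ← normSq_eq_norm_sq]
  congr 1
  rw [normSq_apply] at h ⊢
  simp only [add_re, sub_re, add_im, sub_im]
  linarith

lemma one_sub_norm_le_norm_exp_sub (z : ℂ) (θ : ℝ) :
    1 - ‖z‖ ≤ ‖exp ((θ : ℂ) * I) - z‖ := by
  simpa [norm_exp_ofReal_mul_I] using norm_sub_norm_le (exp ((θ : ℂ) * I)) z

lemma continuous_circleKernel {z : ℂ} (hz : ‖z‖ < 1) : Continuous (circleKernel z) := by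
  refine Continuous.div (by fun_prop) (by fun_prop) fun θ h => ?_
  have := one_sub_norm_le_norm_exp_sub z θ
  rw [h, norm_zero] at this
  linarith

/-- The logarithm of the boundary modulus of an outer function with a boundary zero is
integrable. -/
lemma intervalIntegrable_log_norm {f : ℂ → ℂ} (hout : IsOuter f) {a : ℂ} (ha : a ∈ bZeros f) :
    IntervalIntegrable (fun θ : ℝ => Real.log ‖f (exp ((θ : ℂ) * I))‖) volume 0
      (2 * Real.pi) := by
  by_contra hni
  have hone : ∀ z ∈ uDisc, f z = 1 := by
    intro z hz
    have hz1 : ‖z‖ < 1 := by simpa [uDisc] using hz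
    rw [hout.2.2 z hz, intervalIntegral.integral_undef, mul_zero, exp_zero]
    intro hint
    have hk : ∀ θ, circleKernel z θ ≠ 0 := by
      intro θ h
      have hre := circleKernel_re z θ
      rw [h, zero_re] at hre
      have h1 := one_sub_norm_le_norm_exp_sub z θ
      have h2 : 0 < ‖exp ((θ : ℂ) * I) - z‖ := by linarith
      have h3 : 0 < 1 - ‖z‖ ^ 2 := by nlinarith [norm_nonneg z]
      have : 0 < (1 - ‖z‖ ^ 2) / ‖exp ((θ : ℂ) * I) - z‖ ^ 2 := by positivity
      linarith
    have h := hint.continuousOn_mul (g := fun θ => (circleKernel z θ)⁻¹)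
      ((continuous_circleKernel hz1).inv₀ hk).continuousOn
    apply hni
    have h' : IntervalIntegrable
        (fun θ : ℝ => (Real.log ‖f (exp ((θ : ℂ) * I))‖ : ℂ)) volume 0 (2 * Real.pi) := by
      refine h.congr ?_
      intro θ _
      exact inv_mul_cancel_left₀ (hk θ) _
    exact ⟨h'.1.re, h'.2.re⟩
  have hcl : closure uDisc = closedBall (0 : ℂ) 1 := closure_ball 0 one_ne_zero
  have hac : a ∈ closure uDisc := hcl ▸ sphere_subset_closedBall ha.1
  have h : f a = 1 := by
    have := (hcl ▸ hout.1.2 : ContinuousOn f (closure uDisc))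
    exact EqOn.of_subset_closure hone this continuousOn_const subset_closure subset_rfl hac
  rw [ha.2] at h
  exact zero_ne_one h

/-- The Poisson formula for the modulus of an outer function. -/
lemma norm_eq_exp_of_isOuter {f : ℂ → ℂ} (hout : IsOuter f) {a : ℂ} (ha : a ∈ bZeros f)
    {z : ℂ} (hz : ‖z‖ < 1) :
    ‖f z‖ = Real.exp (-((1 / (2 * Real.pi)) * ∫ θ in Ico (0 : ℝ) (2 * Real.pi),
      (1 - ‖z‖ ^ 2) / ‖exp ((θ : ℂ) * I) - z‖ ^ 2 * -Real.log ‖f (exp ((θ : ℂ) * I))‖)) := by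
  have hL := intervalIntegrable_log_norm hout ha
  have hK : IntervalIntegrable (fun θ : ℝ => circleKernel z θ *
      (Real.log ‖f (exp ((θ : ℂ) * I))‖ : ℂ)) volume 0 (2 * Real.pi) :=
    IntervalIntegrable.continuousOn_mul ⟨hL.1.ofReal, hL.2.ofReal⟩
      (continuous_circleKernel hz).continuousOn
  rw [hout.2.2 z (by simpa [uDisc] using hz), norm_exp]
  congr 1
  have hc : (1 / (2 * (Real.pi : ℂ))) = ((1 / (2 * Real.pi) : ℝ) : ℂ) := by push_cast; rfl
  have hpi : (0 : ℝ) ≤ 2 * Real.pi := by positivity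
  rw [hc, re_ofReal_mul, intervalIntegral.integral_of_le hpi,
    ← integral_Ico_eq_integral_Ioc]
  have hI : IntegrableOn (fun θ : ℝ => circleKernel z θ *
      (Real.log ‖f (exp ((θ : ℂ) * I))‖ : ℂ)) (Ico 0 (2 * Real.pi)) :=
    (integrableOn_congr_set_ae Ico_ae_eq_Ioc).2 hK.1
  rw [← mul_neg, ← integral_neg]
  congr 1
  refine (integral_re hI).symm.trans (integral_congr_ae ?_)
  filter_upwards with θ
  rw [← circleKernel_re]
  simp

/-- For `z ∈ Δ_γ²²` and `μ_z = 1 − 8|log d(z)|/a_γ(z)`, one has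
`|f(μ_z z)| ≤ d(z)²`. -/
theorem mu_point_small (α : ℝ) (hα0 : 0 < α) (hα1 : α ≤ 1/2)
    (f : ℂ → ℂ) (Γ γ : Set ℂ) (a b : ℂ)
    (hf : MemA α f) (hout : IsOuter f) (hnorm : ANorm α f ≤ 1)
    (hΓ : IsArcUnion f Γ) (hγ : IsCompArc f γ)
    (hlen : volume (angSet γ) < ENNReal.ofReal (1/2))
    (ha : a ∈ bZeros f) (hb : b ∈ bZeros f)
    (hclo : closure γ = insert a (insert b γ))
    (hd : ∀ z ∈ sector2 a b γ, dd a b z ≤ 1/2) :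
    ∀ z ∈ sector22 f Γ γ a b,
      ‖f ((muOf f Γ γ a b z : ℂ) * z)‖ ≤ dd a b z ^ 2 := by
  rintro z ⟨⟨hzγ, hz2⟩, hlo, hhi⟩
  have hdle := hd z ⟨hzγ, hz2⟩
  have hreg : IsDiscReg f := hout.1
  have hz1 : ‖z‖ < 1 := by simpa [uDisc] using hzγ.1
  set d := dd a b z with hd_def
  have hd0 : 0 < d := by linarith
  have hlog : Real.log d < 0 := Real.log_neg hd0 (by linarith)
  have habs : |Real.log d| = -Real.log d := abs_of_neg hlog
  set A := aFun f Γ γ z with hA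
  have hnum : 0 < 8 * |Real.log d| := by rw [habs]; linarith
  have hApos : 0 < A := lt_trans (by positivity) hlo
  set μ := muOf f Γ γ a b z with hμ_def
  have hμ : 1 - μ = 8 * |Real.log d| / A := by rw [hμ_def, muOf]; ring
  have hμd : 1 - μ < d := by
    rw [hμ, div_lt_iff₀ hApos]
    rwa [div_lt_iff₀ hd0, mul_comm A] at hlo
  have hμ1 : 0 < 1 - μ := by rw [hμ]; positivity
  have hμA : (1 - μ) * A = -8 * Real.log d := by
    rw [hμ, div_mul_cancel₀ _ hApos.ne', habs]; ring
  have hμ0 : 0 < μ := by linarith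
  have hμz : ‖(μ : ℂ) * z‖ = μ * ‖z‖ := by
    rw [norm_mul, norm_real, Real.norm_of_nonneg hμ0.le]
  have hμz1 : ‖(μ : ℂ) * z‖ < 1 := by
    rw [hμz]; nlinarith [norm_nonneg z]
  set L : ℝ → ℝ := fun θ => -Real.log ‖f (exp ((θ : ℂ) * I))‖ with hL
  have hL0 : ∀ θ, 0 ≤ L θ := fun θ =>
    neg_nonneg.2 (Real.log_nonpos (norm_nonneg _)
      (norm_le_one_of_ANorm_le_one_s13 hreg hnorm (by simp [norm_exp_ofReal_mul_I])))
  have hLint : IntegrableOn L (Ico 0 (2 * Real.pi)) :=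
    (integrableOn_congr_set_ae Ico_ae_eq_Ioc).2 (intervalIntegrable_log_norm hout ha).1.neg
  have hker : ∀ {w : ℂ}, ‖w‖ < 1 → ∀ c : ℝ, IntegrableOn
      (fun θ : ℝ => c / ‖exp ((θ : ℂ) * I) - w‖ ^ 2 * L θ) (Ico 0 (2 * Real.pi)) := by
    intro w hw c
    have hcont : Continuous fun θ : ℝ => c / ‖exp ((θ : ℂ) * I) - w‖ ^ 2 := by
      refine Continuous.div continuous_const (by fun_prop) fun θ => ?_
      have := one_sub_norm_le_norm_exp_sub w θ
      have : 0 < ‖exp ((θ : ℂ) * I) - w‖ := by linarith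
      positivity
    exact (((integrableOn_Icc_iff_integrableOn_Ico).2 hLint).continuousOn_mul
      hcont.continuousOn isCompact_Icc).mono_set Ico_subset_Icc_self
  have hγoff : γ ⊆ offZeros f := by
    obtain ⟨x, -, rfl⟩ := hγ
    exact connectedComponentIn_subset _ _
  have hγmeas : MeasurableSet γ := by
    have h : γ = closure γ \ {a, b} := by
      rw [hclo]
      ext w
      simp only [Set.mem_sdiff, mem_insert_iff, mem_singleton_iff]
      constructor
      · intro hw
        refine ⟨Or.inr (Or.inr hw), ?_⟩
        rintro (rfl | rfl)
        · exact (hγoff hw).2 ha.2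
        · exact (hγoff hw).2 hb.2
      · tauto
    rw [h]
    exact isClosed_closure.measurableSet.diff (Set.toFinite _).measurableSet
  set T : Set ℝ := angSet (uCircle \ γ) with hT
  have hTmeas : MeasurableSet T := by
    refine measurableSet_Ico.inter ?_
    have hc : Continuous fun θ : ℝ => exp ((θ : ℂ) * I) := by fun_prop
    exact hc.measurable (isClosed_sphere.measurableSet.diff hγmeas)
  have hTsub : T ⊆ Ico 0 (2 * Real.pi) := fun θ h => h.1
  have hST : angSet (lamSet Γ γ) ⊆ T := fun θ h => ⟨h.1, lamSet_subset hΓ hγ h.2⟩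
  set M : ℝ := 1 - ‖(μ : ℂ) * z‖ ^ 2 with hM
  have hMμ : 1 - μ ≤ M := by
    rw [hM, hμz, mul_pow]
    have : ‖z‖ ^ 2 ≤ 1 := pow_le_one₀ (norm_nonneg z) hz1.le
    nlinarith [sq_nonneg μ]
  have hM0 : 0 < M := hμ1.trans_le hMμ
  have hnn : ∀ (w : ℂ) (c : ℝ), 0 ≤ c → ∀ θ : ℝ, 0 ≤ c / ‖exp ((θ : ℂ) * I) - w‖ ^ 2 * L θ :=
    fun w c hc θ => mul_nonneg (by positivity) (hL0 θ)
  have hpt : ∀ θ ∈ T, M / 4 / ‖exp ((θ : ℂ) * I) - z‖ ^ 2 * L θ ≤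
      M / ‖exp ((θ : ℂ) * I) - (μ : ℂ) * z‖ ^ 2 * L θ := by
    intro θ hθ
    have hdθ : d ≤ ‖exp ((θ : ℂ) * I) - z‖ :=
      dd_le_norm_sub_of_notMem hreg hγ hclo hzγ hθ.2.1 hθ.2.2
    refine mul_le_mul_of_nonneg_right ?_ (hL0 θ)
    have hpos : 0 < ‖exp ((θ : ℂ) * I) - (μ : ℂ) * z‖ := by
      have := one_sub_norm_le_norm_exp_sub ((μ : ℂ) * z) θ
      linarith
    have htri : ‖exp ((θ : ℂ) * I) - (μ : ℂ) * z‖ ≤ 2 * ‖exp ((θ : ℂ) * I) - z‖ := by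
      have h : exp ((θ : ℂ) * I) - (μ : ℂ) * z =
          (exp ((θ : ℂ) * I) - z) + ((1 - μ : ℝ) : ℂ) * z := by push_cast; ring
      have h2 : ‖((1 - μ : ℝ) : ℂ) * z‖ ≤ d := by
        rw [norm_mul, norm_real, Real.norm_of_nonneg hμ1.le]
        nlinarith [norm_nonneg z]
      rw [h]
      linarith [norm_add_le (exp ((θ : ℂ) * I) - z) (((1 - μ : ℝ) : ℂ) * z)]
    rw [div_div]
    refine div_le_div_of_nonneg_left hM0.le (by positivity) ?_
    calc ‖exp ((θ : ℂ) * I) - (μ : ℂ) * z‖ ^ 2 ≤ (2 * ‖exp ((θ : ℂ) * I) - z‖) ^ 2 := by gcongr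
      _ = 4 * ‖exp ((θ : ℂ) * I) - z‖ ^ 2 := by ring
  have hA_eq : M / 4 * A = (1 / (2 * Real.pi)) * ∫ θ in angSet (lamSet Γ γ),
      M / 4 / ‖exp ((θ : ℂ) * I) - z‖ ^ 2 * L θ := by
    rw [hA, aFun, mul_left_comm, ← integral_const_mul]
    congr 2
    ext θ
    simp only [hL]
    ring
  have hchain : M / 4 * A ≤ (1 / (2 * Real.pi)) * ∫ θ in Ico (0 : ℝ) (2 * Real.pi),
      M / ‖exp ((θ : ℂ) * I) - (μ : ℂ) * z‖ ^ 2 * L θ := by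
    rw [hA_eq]
    refine mul_le_mul_of_nonneg_left ?_ (by positivity)
    calc ∫ θ in angSet (lamSet Γ γ), M / 4 / ‖exp ((θ : ℂ) * I) - z‖ ^ 2 * L θ
        ≤ ∫ θ in T, M / 4 / ‖exp ((θ : ℂ) * I) - z‖ ^ 2 * L θ :=
          setIntegral_mono_set ((hker hz1 _).mono_set hTsub)
            (Eventually.of_forall (hnn z _ (by positivity))) hST.eventuallyLE
      _ ≤ ∫ θ in T, M / ‖exp ((θ : ℂ) * I) - (μ : ℂ) * z‖ ^ 2 * L θ :=
          setIntegral_mono_on ((hker hz1 _).mono_set hTsub) ((hker hμz1 _).mono_set hTsub)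
            hTmeas hpt
      _ ≤ ∫ θ in Ico (0 : ℝ) (2 * Real.pi), M / ‖exp ((θ : ℂ) * I) - (μ : ℂ) * z‖ ^ 2 * L θ :=
          setIntegral_mono_set (hker hμz1 _)
            (Eventually.of_forall (hnn _ _ hM0.le)) hTsub.eventuallyLE
  rw [norm_eq_exp_of_isOuter hout ha hμz1]
  calc _ ≤ Real.exp (2 * Real.log d) := by
        refine Real.exp_le_exp.2 ?_
        have h := mul_le_mul_of_nonneg_right hMμ hApos.le
        refine (neg_le_neg hchain).trans ?_
        linarith
    _ = d ^ 2 := by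
        rw [two_mul, Real.exp_add, Real.exp_log hd0, sq]
end
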